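/- arXiv:0810.5113 — 2 statements merged into one kernel-verified Lean document; each statement's English description precedes it below -/
import Mathlib

section
/- Fix a finite alphabet A with m letters and a finite set B of nonempty words over A such that no element of B is a factor of another element of B. Let a(n) be the number of words of length n over A containing no element of B as a factor, and let c(k) = Σ_{(w,S) a cluster with |w| = k} (−1)^{|S|}. Then for every n ≥ 1, a(n) = m·a(n−1) + Σ_{k=1}^{n} c(k)·a(n−k). -/
open scoped Classical

/-- The set of occurrences of forbidden words of `B` in the word `w`:
pairs `(i, b)` with `b ∈ B` such that `b` occurs as a factor of `w` starting at position `i`. -/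
def Occ {A : Type} [DecidableEq A] (B : Finset (List A)) (w : List A) :
    Finset (ℕ × List A) :=
  (Finset.range (w.length + 1) ×ˢ B).filter fun p =>
    p.1 + p.2.length ≤ w.length ∧ (w.drop p.1).take p.2.length = p.2

/-- Two occurrences `p = (i, b)` and `q = (i', b')` overlap if they share at least one
position, i.e. the intervals `[i, i + |b|)` and `[i', i' + |b'|)` intersect. -/
def Overlaps {A : Type} (p q : ℕ × List A) : Prop :=
  ∃ j, p.1 ≤ j ∧ j < p.1 + p.2.length ∧ q.1 ≤ j ∧ j < q.1 + q.2.length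

/-- `(w, S)` is a cluster: `S` is a nonempty set of occurrences of `B` in `w`, some occurrence
starts at position 0, the occurrences of `S` cover every position of `w`, and any two
occurrences that are consecutive in increasing order of starting position (no occurrence of
`S` starts strictly between them) overlap. -/
def IsCluster {A : Type} [DecidableEq A] (B : Finset (List A)) (w : List A)
    (S : Finset (ℕ × List A)) : Prop :=
  S ⊆ Occ B w ∧ S.Nonempty ∧
    (∃ p ∈ S, p.1 = 0) ∧
    (∀ j < w.length, ∃ p ∈ S, p.1 ≤ j ∧ j < p.1 + p.2.length) ∧
    (∀ p ∈ S, ∀ q ∈ S, p.1 < q.1 → (∀ r ∈ S, ¬(p.1 < r.1 ∧ r.1 < q.1)) → Overlaps p q)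

/-- `c(k)`: the signed count `Σ (-1)^{|S|}` over all clusters `(w, S)` with `|w| = k`. -/
noncomputable def clusterCount (A : Type) [Fintype A] [DecidableEq A]
    (B : Finset (List A)) (k : ℕ) : ℤ :=
  ∑ w : Fin k → A, ∑ S ∈ (Occ B (List.ofFn w)).powerset,
    if IsCluster B (List.ofFn w) S then (-1 : ℤ) ^ S.card else 0

/-- `a(n)`: the number of words of length `n` over `A` avoiding every word of `B` as a
factor. -/
def countAvoid (A : Type) [Fintype A] [DecidableEq A] (B : Finset (List A)) (n : ℕ) : ℕ :=
  (Finset.univ.filter fun w : Fin n → A => ∀ b ∈ B, ¬ b <:+: List.ofFn w).card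

section ClusterMethod

variable {A : Type} [DecidableEq A] {B : Finset (List A)} {w : List A}

theorem mem_Occ {p : ℕ × List A} :
    p ∈ Occ B w ↔ p.2 ∈ B ∧ p.1 + p.2.length ≤ w.length ∧
      (w.drop p.1).take p.2.length = p.2 := by
  simp only [Occ, Finset.mem_filter, Finset.mem_product, Finset.mem_range]
  constructor
  · tauto
  · rintro ⟨h1, h2, h3⟩
    exact ⟨⟨by omega, h1⟩, h2, h3⟩

theorem mem_Occ_take {k : ℕ} {p : ℕ × List A} :
    p ∈ Occ B (w.take k) ↔ p ∈ Occ B w ∧ p.1 + p.2.length ≤ k := by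
  simp only [mem_Occ, List.length_take, le_min_iff, List.drop_take, List.take_take]
  constructor
  · rintro ⟨h1, ⟨h2, h3⟩, h4⟩
    rw [min_eq_left (by omega)] at h4
    exact ⟨⟨h1, h3, h4⟩, h2⟩
  · rintro ⟨⟨h1, h3, h4⟩, h2⟩
    rw [min_eq_left (by omega)]
    exact ⟨h1, ⟨h2, h3⟩, h4⟩

/-- Translate the starting position of an occurrence by `k`. -/
def shiftOcc (A : Type) (k : ℕ) : ℕ × List A ↪ ℕ × List A :=
  (addLeftEmbedding k).prodMap (Function.Embedding.refl _)

theorem map_shiftOcc_Occ_drop {k : ℕ} (hk : k ≤ w.length) :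
    (Occ B (w.drop k)).map (shiftOcc A k) = (Occ B w).filter fun p => k ≤ p.1 := by
  ext ⟨i, b⟩
  simp only [Finset.mem_map, Finset.mem_filter, mem_Occ, List.length_drop, List.drop_drop,
    Prod.exists, shiftOcc, Function.Embedding.coe_prodMap, Prod.map_apply,
    Function.Embedding.refl_apply, addLeftEmbedding_apply, Prod.mk.injEq]
  constructor
  · rintro ⟨j, c, ⟨h1, h2, h3⟩, rfl, rfl⟩
    exact ⟨⟨h1, by omega, h3⟩, by omega⟩
  · rintro ⟨⟨h1, h2, h3⟩, h4⟩
    refine ⟨i - k, b, ⟨h1, by omega, ?_⟩, by omega, rfl⟩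
    rwa [Nat.add_sub_cancel' h4]

/-- In a factor-free set of words, no occurrence is nested inside another one. -/
theorem Occ_eq_of_nested (hfac : ∀ u ∈ B, ∀ v ∈ B, u ≠ v → ¬ u <:+: v)
    {p r : ℕ × List A} (hp : p ∈ Occ B w) (hr : r ∈ Occ B w) (h1 : r.1 ≤ p.1)
    (h2 : p.1 + p.2.length ≤ r.1 + r.2.length) : p = r := by
  rw [mem_Occ] at hp hr
  have hsub : p.2 = (r.2.drop (p.1 - r.1)).take p.2.length := by
    rw [← hr.2.2, List.drop_take, List.drop_drop, List.take_take, Nat.add_sub_cancel' h1,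
      min_eq_left (by omega), hp.2.2]
  have hinf : p.2 <:+: r.2 := by
    rw [hsub]
    exact (List.take_prefix _ _).isInfix.trans (List.drop_suffix _ _).isInfix
  have heq : p.2 = r.2 := by
    by_contra hne
    exact hfac _ hp.1 _ hr.1 hne hinf
  refine Prod.ext ?_ heq
  rw [heq] at h2
  omega

/-- Some occurrence in `S` covers both positions `j - 1` and `j`. -/
def Crosses (S : Finset (ℕ × List A)) (j : ℕ) : Prop :=
  ∃ p ∈ S, p.1 < j ∧ j < p.1 + p.2.length

theorem isCluster_iff (hB : ∀ b ∈ B, b ≠ [])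
    (hfac : ∀ u ∈ B, ∀ v ∈ B, u ≠ v → ¬ u <:+: v) {S : Finset (ℕ × List A)}
    (hS : S ⊆ Occ B w) :
    IsCluster B w S ↔ (∃ p ∈ S, p.1 = 0) ∧ ∀ j, 0 < j → j < w.length → Crosses S j := by
  constructor
  · rintro ⟨-, -, ⟨z, hz, hz0⟩, hcov, hcons⟩
    refine ⟨⟨z, hz, hz0⟩, fun j hj hjw => ?_⟩
    obtain ⟨p, hp, hpj, hjp⟩ := hcov j hjw
    rcases hpj.lt_or_eq with hlt | heq
    · exact ⟨p, hp, hlt, hjp⟩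
    obtain ⟨q, hq, hmax⟩ := (S.filter fun q => q.1 < j).exists_max_image Prod.fst
      ⟨z, by simp [hz, hz0, hj]⟩
    simp only [Finset.mem_filter] at hq hmax
    obtain ⟨i, h1, h2, h3, h4⟩ := hcons q hq.1 p hp (by omega) fun r hr hbt => by
      have := hmax r ⟨hr, by omega⟩
      omega
    exact ⟨q, hq.1, hq.2, by omega⟩
  · rintro ⟨⟨z, hz, hz0⟩, hcr⟩
    have hpos : ∀ p ∈ S, 0 < p.2.length := fun p hp =>
      List.length_pos_iff.2 (hB _ (mem_Occ.1 (hS hp)).1)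
    refine ⟨hS, ⟨z, hz⟩, ⟨z, hz, hz0⟩, fun j hj => ?_, fun p hp q hq hpq hbt => ?_⟩
    · rcases Nat.eq_zero_or_pos j with rfl | hj0
      · exact ⟨z, hz, by omega, by have := hpos z hz; omega⟩
      · obtain ⟨p, hp, h1, h2⟩ := hcr j hj0 hj
        exact ⟨p, hp, h1.le, h2⟩
    · have hqw := (mem_Occ.1 (hS hq)).2.1
      have hql := hpos q hq
      obtain ⟨r, hr, h1, h2⟩ := hcr q.1 (by omega) (by omega)
      have hrp : r.1 ≤ p.1 := by
        by_contra hlt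
        exact hbt r hr ⟨by omega, h1⟩
      refine ⟨q.1, hpq.le, ?_, le_rfl, by omega⟩
      by_contra hend
      have := Occ_eq_of_nested hfac (hS hp) (hS hr) hrp (by omega)
      subst this
      omega

/-- The signed count of all sets of occurrences in `w`. -/
noncomputable def markedSum (B : Finset (List A)) (w : List A) : ℤ :=
  ∑ S ∈ (Occ B w).powerset, (-1) ^ S.card

/-- The signed count of all clusters on the word `w`. -/
noncomputable def clusterSum (B : Finset (List A)) (w : List A) : ℤ :=
  ∑ S ∈ (Occ B w).powerset, if IsCluster B w S then (-1 : ℤ) ^ S.card else 0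

theorem Occ_eq_empty_iff : Occ B w = ∅ ↔ ∀ b ∈ B, ¬ b <:+: w := by
  rw [Finset.eq_empty_iff_forall_notMem]
  constructor
  · rintro h b hb ⟨s, t, rfl⟩
    refine h (s.length, b) (mem_Occ.2 ⟨hb, by simp, ?_⟩)
    simp [List.append_assoc]
  · intro h p hp
    rw [mem_Occ] at hp
    refine h _ hp.1 ?_
    rw [← hp.2.2]
    exact (List.take_prefix _ _).isInfix.trans (List.drop_suffix _ _).isInfix

theorem markedSum_eq : markedSum B w = if ∀ b ∈ B, ¬ b <:+: w then 1 else 0 := by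
  simp only [markedSum, Finset.sum_powerset_neg_one_pow_card, Occ_eq_empty_iff]

theorem countAvoid_eq_sum_markedSum [Fintype A] (n : ℕ) :
    (countAvoid A B n : ℤ) = ∑ w : Fin n → A, markedSum B (List.ofFn w) := by
  simp [countAvoid, markedSum_eq, Finset.sum_boole]

theorem markedSum_drop {k : ℕ} (hk : k ≤ w.length) :
    markedSum B (w.drop k) =
      ∑ S ∈ ((Occ B w).filter fun p => k ≤ p.1).powerset, (-1) ^ S.card := by
  rw [markedSum, Finset.sum_powerset_neg_one_pow_card, Finset.sum_powerset_neg_one_pow_card,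
    ← map_shiftOcc_Occ_drop hk]
  simp only [Finset.map_eq_empty]

/-- Cutting a word at a position `k` that no marked occurrence crosses. -/
theorem clusterSum_take_mul_markedSum_drop (hB : ∀ b ∈ B, b ≠ [])
    (hfac : ∀ u ∈ B, ∀ v ∈ B, u ≠ v → ¬ u <:+: v) {k : ℕ} (hk0 : 0 < k)
    (hk : k ≤ w.length) :
    clusterSum B (w.take k) * markedSum B (w.drop k) =
      ∑ S ∈ (Occ B w).powerset,
        if (∃ p ∈ S, p.1 = 0) ∧ (∀ j, 0 < j → j < k → Crosses S j) ∧ ¬ Crosses S k then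
          (-1 : ℤ) ^ S.card else 0 := by
  have hlen : (w.take k).length = k := by simpa using hk
  rw [markedSum_drop hk, clusterSum, ← Finset.sum_filter, Finset.sum_mul_sum,
    ← Finset.sum_product', ← Finset.sum_filter]
  have hpos : ∀ p ∈ Occ B w, 0 < p.2.length := fun p hp =>
    List.length_pos_iff.2 (hB _ (mem_Occ.1 hp).1)
  refine Finset.sum_nbij' (fun P => P.1 ∪ P.2)
    (fun S => (S.filter (fun p => p.1 < k), S.filter (fun p => k ≤ p.1))) ?_ ?_ ?_ ?_ ?_
  · rintro ⟨S, T⟩ h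
    simp only [Finset.mem_product, Finset.mem_filter, Finset.mem_powerset] at h ⊢
    obtain ⟨⟨hS, hcl⟩, hT⟩ := h
    rw [isCluster_iff hB hfac hS, hlen] at hcl
    obtain ⟨⟨z, hz, hz0⟩, hcr⟩ := hcl
    refine ⟨Finset.union_subset (fun p hp => (mem_Occ_take.1 (hS hp)).1)
      (fun p hp => (Finset.mem_filter.1 (hT hp)).1),
      ⟨z, Finset.mem_union_left _ hz, hz0⟩, fun j h1 h2 => ?_, ?_⟩
    · obtain ⟨p, hp, h⟩ := hcr j h1 h2
      exact ⟨p, Finset.mem_union_left _ hp, h⟩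
    · rintro ⟨p, hp, h1, h2⟩
      rcases Finset.mem_union.1 hp with hp | hp
      · have := (mem_Occ_take.1 (hS hp)).2
        omega
      · have := (Finset.mem_filter.1 (hT hp)).2
        omega
  · intro S h
    simp only [Finset.mem_product, Finset.mem_filter, Finset.mem_powerset] at h ⊢
    obtain ⟨hS, ⟨z, hz, hz0⟩, hcr, hcut⟩ := h
    have hsub : S.filter (fun p => p.1 < k) ⊆ Occ B (w.take k) := by
      intro p hp
      rw [Finset.mem_filter] at hp
      refine mem_Occ_take.2 ⟨hS hp.1, ?_⟩
      by_contra hlt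
      exact hcut ⟨p, hp.1, hp.2, by omega⟩
    refine ⟨⟨hsub, (isCluster_iff hB hfac hsub).2 ⟨⟨z, ?_, hz0⟩, fun j h1 h2 => ?_⟩⟩,
      Finset.filter_subset_filter _ hS⟩
    · simp [hz, hz0, hk0]
    · obtain ⟨p, hp, h3, h4⟩ := hcr j h1 (by omega)
      exact ⟨p, by simp only [Finset.mem_filter]; exact ⟨hp, by omega⟩, h3, h4⟩
  · rintro ⟨S, T⟩ h
    simp only [Finset.mem_product, Finset.mem_filter, Finset.mem_powerset] at h
    obtain ⟨⟨hS, -⟩, hT⟩ := h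
    have hS' : ∀ p ∈ S, p.1 < k := fun p hp => by
      have h1 := mem_Occ_take.1 (hS hp)
      have h2 := hpos p h1.1
      omega
    have hT' : ∀ p ∈ T, k ≤ p.1 := fun p hp => (Finset.mem_filter.1 (hT hp)).2
    refine Prod.ext ?_ ?_
    · ext p
      simp only [Finset.mem_filter, Finset.mem_union]
      exact ⟨fun h => h.1.resolve_right fun hp => absurd (hT' p hp) (by omega),
        fun h => ⟨Or.inl h, hS' p h⟩⟩
    · ext p
      simp only [Finset.mem_filter, Finset.mem_union]
      exact ⟨fun h => h.1.resolve_left fun hp => absurd (hS' p hp) (by omega),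
        fun h => ⟨Or.inr h, hT' p h⟩⟩
  · intro S _
    ext p
    simp only [Finset.mem_union, Finset.mem_filter, ← and_or_left]
    exact ⟨And.left, fun h => ⟨h, lt_or_ge _ _⟩⟩
  · rintro ⟨S, T⟩ h
    simp only [Finset.mem_product, Finset.mem_filter, Finset.mem_powerset] at h
    obtain ⟨⟨hS, -⟩, hT⟩ := h
    have hdisj : Disjoint S T := by
      rw [Finset.disjoint_left]
      intro p hp hq
      have h1 := mem_Occ_take.1 (hS hp)
      have h2 := hpos p h1.1
      have h3 := (Finset.mem_filter.1 (hT hq)).2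
      omega
    rw [Finset.card_union_of_disjoint hdisj, pow_add]

/-- The first uncrossed position after `0` is unique. -/
theorem sum_first_uncrossed {S : Finset (ℕ × List A)} (hS : S ⊆ Occ B w) (hw : 1 ≤ w.length)
    (c : ℤ) :
    (∑ k ∈ Finset.Icc 1 w.length,
      if (∀ j, 0 < j → j < k → Crosses S j) ∧ ¬ Crosses S k then c else 0) = c := by
  have hex : ∃ k, 0 < k ∧ ¬ Crosses S k := by
    refine ⟨w.length, hw, ?_⟩
    rintro ⟨p, hp, h1, h2⟩
    have := (mem_Occ.1 (hS hp)).2.1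
    omega
  obtain ⟨h1, h2⟩ := Nat.find_spec hex
  have hmin : ∀ j, 0 < j → j < Nat.find hex → Crosses S j := fun j hj hlt => by
    by_contra hc
    exact Nat.find_min hex hlt ⟨hj, hc⟩
  have hle : Nat.find hex ≤ w.length := by
    refine Nat.find_min' hex ⟨hw, ?_⟩
    rintro ⟨p, hp, h1, h2⟩
    have := (mem_Occ.1 (hS hp)).2.1
    omega
  rw [Finset.sum_eq_single_of_mem (Nat.find hex) (Finset.mem_Icc.2 ⟨h1, hle⟩),
    if_pos ⟨hmin, h2⟩]
  intro k hk hne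
  refine if_neg fun ⟨hk1, hk2⟩ => ?_
  rcases hne.lt_or_gt with hlt | hgt
  · exact hk2 (hmin k (Finset.mem_Icc.1 hk).1 hlt)
  · exact h2 (hk1 _ h1 hgt)

/-- The cluster recursion for a single word. -/
theorem markedSum_eq_add_sum (hB : ∀ b ∈ B, b ≠ [])
    (hfac : ∀ u ∈ B, ∀ v ∈ B, u ≠ v → ¬ u <:+: v) (hw : 1 ≤ w.length) :
    markedSum B w = markedSum B (w.drop 1) +
      ∑ k ∈ Finset.Icc 1 w.length, clusterSum B (w.take k) * markedSum B (w.drop k) := by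
  have hclusters : ∑ k ∈ Finset.Icc 1 w.length,
      clusterSum B (w.take k) * markedSum B (w.drop k) =
      ∑ S ∈ (Occ B w).powerset, if ∃ p ∈ S, p.1 = 0 then (-1 : ℤ) ^ S.card else 0 := by
    rw [Finset.sum_congr rfl fun k hk => clusterSum_take_mul_markedSum_drop hB hfac
      (Finset.mem_Icc.1 hk).1 (Finset.mem_Icc.1 hk).2, Finset.sum_comm]
    refine Finset.sum_congr rfl fun S hS => ?_
    by_cases h0 : ∃ p ∈ S, p.1 = 0
    · simp only [h0, true_and, if_true]
      exact sum_first_uncrossed (Finset.mem_powerset.1 hS) hw _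
    · simp [h0]
  have htail : markedSum B (w.drop 1) =
      ∑ S ∈ (Occ B w).powerset, if ¬ ∃ p ∈ S, p.1 = 0 then (-1 : ℤ) ^ S.card else 0 := by
    rw [markedSum_drop hw, ← Finset.sum_filter]
    congr 1
    ext S
    simp only [Finset.mem_powerset, Finset.mem_filter, Finset.subset_iff, Nat.one_le_iff_ne_zero]
    exact ⟨fun h => ⟨fun p hp => (h hp).1, fun ⟨p, hp, h0⟩ => (h hp).2 h0⟩,
      fun h p hp => ⟨h.1 hp, fun h0 => h.2 ⟨p, hp, h0⟩⟩⟩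
  rw [hclusters, htail, add_comm, ← Finset.sum_filter, ← Finset.sum_filter,
    Finset.sum_filter_add_sum_filter_not, markedSum]

end ClusterMethod

theorem sum_take_mul_drop {A : Type} [Fintype A] (k l : ℕ) (g h : List A → ℤ) :
    ∑ w : Fin (k + l) → A, g ((List.ofFn w).take k) * h ((List.ofFn w).drop k) =
      (∑ u : Fin k → A, g (List.ofFn u)) * ∑ v : Fin l → A, h (List.ofFn v) := by
  rw [Finset.sum_mul_sum, ← Finset.sum_product', Finset.univ_product_univ,
    ← (Fin.appendEquiv k l).sum_comp]
  refine Finset.sum_congr rfl fun P _ => ?_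
  have happ : List.ofFn (Fin.appendEquiv k l P) = List.ofFn P.1 ++ List.ofFn P.2 :=
    List.ofFn_fin_append P.1 P.2
  rw [happ, List.take_left' (by simp), List.drop_left' (by simp)]

/-- The fundamental cluster recursion: for `n ≥ 1`,
`a(n) = m·a(n-1) + Σ_{k=1}^{n} c(k)·a(n-k)`, where `m = |A|`. -/
theorem cluster_recursion (A : Type) [Fintype A] [DecidableEq A]
    (B : Finset (List A)) (hB : ∀ b ∈ B, b ≠ [])
    (hfac : ∀ u ∈ B, ∀ v ∈ B, u ≠ v → ¬ u <:+: v)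
    (n : ℕ) (hn : 1 ≤ n) :
    (countAvoid A B n : ℤ) =
      (Fintype.card A : ℤ) * countAvoid A B (n - 1) +
        ∑ k ∈ Finset.Icc 1 n, clusterCount A B k * countAvoid A B (n - k) := by
  have hsplit : ∀ k ∈ Finset.Icc 1 n, ∀ g : List A → ℤ,
      ∑ w : Fin n → A, g ((List.ofFn w).take k) * markedSum B ((List.ofFn w).drop k) =
        (∑ u : Fin k → A, g (List.ofFn u)) * countAvoid A B (n - k) := by
    intro k hk g
    obtain ⟨l, rfl⟩ := Nat.exists_eq_add_of_le (Finset.mem_Icc.1 hk).2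
    rw [sum_take_mul_drop, Nat.add_sub_cancel_left, countAvoid_eq_sum_markedSum]
  have htail := hsplit 1 (Finset.mem_Icc.2 ⟨le_rfl, hn⟩) fun _ => 1
  simp only [one_mul, Finset.sum_const, Finset.card_univ, Fintype.card_fun, Fintype.card_fin,
    pow_one, nsmul_eq_mul, mul_one] at htail
  have hclusters : ∑ k ∈ Finset.Icc 1 n, clusterCount A B k * countAvoid A B (n - k) = _ :=
    Finset.sum_congr rfl fun k hk => (hsplit k hk (clusterSum B)).symm
  rw [countAvoid_eq_sum_markedSum, ← htail, hclusters, Finset.sum_comm,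
    ← Finset.sum_add_distrib]
  refine Finset.sum_congr rfl fun w _ => ?_
  have hrec := markedSum_eq_add_sum (w := List.ofFn w) hB hfac (by simpa using hn)
  rwa [List.length_ofFn] at hrec
end

section
/- Fix a finite alphabet A and a finite set B of nonempty words over A, and let a(n) be the number of words of length n over A containing no element of B as a factor. Then the generating function f(t) = Σ_{n≥0} a(n)·t^n ∈ ℤ⟦t⟧ is rational: there exist polynomials p, q ∈ ℤ[t] with constant term of q equal to 1 such that q·f = p as formal power series over ℤ. -/
open Matrix in
/-- Each coordinate of a vector sequence satisfying `c (n + 1) = M *ᵥ c n` has a rational generating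
function with denominator `M.charpolyRev`. -/
theorem Matrix.exists_charpolyRev_mul_mk_eq {σ R : Type*} [Fintype σ] [DecidableEq σ] [CommRing R]
    (M : Matrix σ σ R) (c : ℕ → σ → R) (hc : ∀ n, c (n + 1) = M *ᵥ c n) (s : σ) :
    ∃ p : Polynomial R,
      (M.charpolyRev : PowerSeries R) * PowerSeries.mk (fun n => c n s) = (p : PowerSeries R) := by
  set N : Matrix σ σ (Polynomial R) := 1 - (Polynomial.X : Polynomial R) • M.map Polynomial.C with hN
  set φ : Polynomial R →+* PowerSeries R := Polynomial.coeToPowerSeries.ringHom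
  set F : σ → PowerSeries R := fun t => PowerSeries.mk fun n => c n t with hF
  have hmap : φ.mapMatrix N = 1 - (PowerSeries.X : PowerSeries R) • M.map PowerSeries.C := by
    rw [hN, map_sub, map_one]
    congr 1
    ext1 i j
    simp [φ, PowerSeries.X_mul]
  have hNF : φ.mapMatrix N *ᵥ F = φ ∘ fun t => Polynomial.C (c 0 t) := by
    funext t
    ext n
    rw [hmap, Matrix.sub_mulVec, Matrix.one_mulVec, Matrix.smul_mulVec]
    cases n with
    | zero => simp [hF, φ]
    | succ n =>
      simp [hF, φ, PowerSeries.coeff_succ_X_mul, Matrix.mulVec, dotProduct, hc]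
  refine ⟨(N.adjugate *ᵥ fun t => Polynomial.C (c 0 t)) s, ?_⟩
  have h := congrArg (fun v => ((φ.mapMatrix N).adjugate *ᵥ v) s) hNF
  simp only [Matrix.mulVec_mulVec, Matrix.adjugate_mul, Matrix.smul_mulVec, Matrix.one_mulVec] at h
  rw [← RingHom.map_det, ← RingHom.map_adjugate] at h
  rw [RingHom.mapMatrix_apply, ← RingHom.map_mulVec] at h
  exact h

open Classical in
/-- The numbers of words of each length in a regular language have a rational generating
function. -/
theorem Language.IsRegular.exists_polynomial_mul_mk_card_eq {α : Type*} [Fintype α]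
    {L : Language α} (hL : L.IsRegular) :
    ∃ p q : Polynomial ℤ, q.coeff 0 = 1 ∧
      (q : PowerSeries ℤ) *
        PowerSeries.mk (fun n => ((Finset.univ.filter fun w : Fin n → α =>
          List.ofFn w ∈ L).card : ℤ)) = (p : PowerSeries ℤ) := by
  obtain ⟨σ, _, D, rfl⟩ := hL
  let c (n : ℕ) (s : σ) : ℤ :=
    (Finset.univ.filter fun w : Fin n → α => List.ofFn w ∈ D.acceptsFrom s).card
  let M : Matrix σ σ ℤ := Matrix.of fun s t => ∑ a, if D.step s a = t then 1 else 0
  have hc (n : ℕ) : c (n + 1) = M.mulVec (c n) := by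
    funext s
    have h : c (n + 1) s = ∑ a, c n (D.step s a) := by
      simp only [c, Finset.card_filter, Nat.cast_sum]
      rw [← (Fin.consEquiv fun _ => α).sum_comp, Fintype.sum_prod_type]
      simp [Fin.consEquiv, List.ofFn_succ, DFA.mem_acceptsFrom]
    simp only [h, M, Matrix.mulVec, dotProduct, Matrix.of_apply, Finset.sum_mul]
    rw [Finset.sum_comm]
    simp
  obtain ⟨p, hp⟩ := M.exists_charpolyRev_mul_mk_eq c hc D.start
  refine ⟨p, M.charpolyRev, ?_, hp⟩
  rw [Polynomial.coeff_zero_eq_eval_zero, Matrix.eval_charpolyRev]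

/-- The language of words avoiding every word of a finite set as a factor is regular. -/
theorem Language.isRegular_avoid {α : Type*} (B : Finset (List α)) :
    Language.IsRegular ({w | ∀ b ∈ B, ¬ b <:+: w} : Language α) := by
  set L : Language α := {w | ∀ b ∈ B, ¬ b <:+: w}
  have mem_L (w : List α) : w ∈ L ↔ ∀ b ∈ B, ¬ b <:+: w := Iff.rfl
  let S (x : List α) : Set (List α) := {s | ∃ p, p ++ s ∈ B ∧ p <:+ x}
  let g (e : Prop × Set (List α)) : Language α := {y | e.1 ∧ y ∈ L ∧ ∀ s ∈ e.2, ¬ s <+: y}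
  have hg (x : List α) : L.leftQuotient x = g (x ∈ L, S x) := by
    ext y
    change x ++ y ∈ L ↔ x ∈ L ∧ y ∈ L ∧ ∀ s ∈ S x, ¬ s <+: y
    simp only [mem_L, List.infix_append_iff, S, Set.mem_ofPred_eq]
    grind
  have hfin : {s | ∃ b ∈ B, s <:+ b}.Finite := by
    refine (B.finite_toSet.biUnion fun b _ => b.tails.finite_toSet).subset ?_
    rintro s ⟨b, hb, hs⟩
    simpa using ⟨b, hb, hs⟩
  apply Language.IsRegular.of_finite_range_leftQuotient
  refine ((Set.finite_univ.prod hfin.finite_subsets).image g).subset ?_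
  rintro _ ⟨x, rfl⟩
  refine ⟨(x ∈ L, S x), ⟨Set.mem_univ _, ?_⟩, (hg x).symm⟩
  rintro s ⟨p, hp, -⟩
  exact ⟨p ++ s, hp, List.suffix_append p s⟩

/-- The generating function `f(t) = Σ a(n) tⁿ` for words avoiding a finite set of forbidden
factors is rational: there are integer polynomials `p, q` with `q(0) = 1` and `q·f = p`. -/
theorem avoid_generating_function_rational (A : Type) [Fintype A] [DecidableEq A]
    (B : Finset (List A)) (hB : ∀ b ∈ B, b ≠ []) :
    ∃ p q : Polynomial ℤ, q.coeff 0 = 1 ∧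
      (q : PowerSeries ℤ) * PowerSeries.mk (fun n => (countAvoid A B n : ℤ)) =
        (p : PowerSeries ℤ) := by
  convert (Language.isRegular_avoid B).exists_polynomial_mul_mk_card_eq using 7 with p q
  funext n
  unfold countAvoid
  congr!
end
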